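/- Let D ⊂ ℂⁿ be a bounded B-regular domain and φ, ψ ∈ PSH⁻(D). Then P[φ](ψ) = P(ψ, g_φ) holds, provided at least one of the following conditions is fulfilled: (i) φ ≥ g_φ + w for some w ∈ PSH⁻(D) with g_w = 0; (ii) g_φ = 0; (iii) φ has approximately model singularity. -/

import Mathlib

open MeasureTheory Filter Topology
open scoped ENNReal

noncomputable section

/-- Complex Euclidean space `ℂⁿ`. -/
abbrev Cn (n : ℕ) : Type := Fin n → ℂ

section Defs

variable {E : Type*} [NormedAddCommGroup E] [NormedSpace ℂ E]

/-- `u` is plurisubharmonic on `Ω`: it is upper semicontinuous on `Ω` (with values in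
`EReal`) and on every closed disc of every complex line contained in `Ω` it satisfies the
maximum principle with respect to real parts of complex polynomials (an equivalent form of
the sub-mean value property on complex lines). -/
def PlurisubharmonicOn (u : E → EReal) (Ω : Set E) : Prop :=
  UpperSemicontinuousOn u Ω ∧
  ∀ a b : E, ∀ r : ℝ, 0 < r →
    (∀ ζ : ℂ, ‖ζ‖ ≤ r → a + ζ • b ∈ Ω) →
    ∀ p : Polynomial ℂ,
      (∀ ζ : ℂ, ‖ζ‖ = r → u (a + ζ • b) ≤ ((Polynomial.eval ζ p).re : EReal)) →
      ∀ ζ : ℂ, ‖ζ‖ ≤ r → u (a + ζ • b) ≤ ((Polynomial.eval ζ p).re : EReal)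

/-- Negative plurisubharmonic functions on `Ω` : the class `PSH⁻(Ω)`. -/
def PSHNeg (u : E → EReal) (Ω : Set E) : Prop :=
  PlurisubharmonicOn u Ω ∧ ∀ z ∈ Ω, u z ≤ 0

/-- A set is pluripolar if it is contained in `{u = -∞}` for some psh `u ≢ -∞`
defined on a neighborhood of the set. -/
def Pluripolar (S : Set E) : Prop :=
  ∃ Ω : Set E, IsOpen Ω ∧ S ⊆ Ω ∧
    ∃ u : E → EReal, PlurisubharmonicOn u Ω ∧ (∃ z ∈ Ω, u z ≠ ⊥) ∧ ∀ z ∈ S, u z = ⊥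

/-- Upper semicontinuous regularization (relative to `Ω`) of a function. -/
def uscReg (f : E → EReal) (Ω : Set E) : E → EReal :=
  fun z => Filter.limsup f (nhdsWithin z Ω)

/-- The psh envelope `P(h)` of a function `h` on `Ω`: the usc regularization of the
supremum of all psh minorants of `h` on `Ω`. -/
def PEnv (h : E → EReal) (Ω : Set E) : E → EReal :=
  uscReg (fun z =>
    ⨆ v ∈ {v : E → EReal | PlurisubharmonicOn v Ω ∧ ∀ x ∈ Ω, v x ≤ h x}, v z) Ω

/-- The rooftop envelope `P(u,v) = P(min{u,v})`. -/
def Rooftop (u v : E → EReal) (Ω : Set E) : E → EReal :=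
  PEnv (fun z => min (u z) (v z)) Ω

/-- The Green–Poisson residual function `g_φ`: usc regularization of the supremum of all
negative psh `w` with `w ≤ φ + C_w` on `Ω` for some constant `C_w`. -/
def gp (φ : E → EReal) (Ω : Set E) : E → EReal :=
  uscReg (fun z =>
    ⨆ w ∈ {w : E → EReal | PSHNeg w Ω ∧ ∃ C : ℝ, ∀ x ∈ Ω, w x ≤ φ x + (C : EReal)}, w z) Ω

/-- The residual Green function `g_φ^o`: usc regularization of the supremum of all
negative psh `w` with `w ≤ φ + O(1)` locally in `Ω`. -/
def gpO (φ : E → EReal) (Ω : Set E) : E → EReal :=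
  uscReg (fun z =>
    ⨆ w ∈ {w : E → EReal | PSHNeg w Ω ∧
      ∀ a ∈ Ω, ∃ U ∈ nhds a, ∃ C : ℝ, ∀ x ∈ U ∩ Ω, w x ≤ φ x + (C : EReal)}, w z) Ω

/-- The residual Poisson function `g_φ^b`: usc regularization of the supremum of all
negative psh `w` with `w ≤ φ + O(1)` in a neighborhood of `∂Ω`. -/
def gpB (φ : E → EReal) (Ω : Set E) : E → EReal :=
  uscReg (fun z =>
    ⨆ w ∈ {w : E → EReal | PSHNeg w Ω ∧
      ∃ U : Set E, IsOpen U ∧ frontier Ω ⊆ U ∧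
        ∃ C : ℝ, ∀ x ∈ U ∩ Ω, w x ≤ φ x + (C : EReal)}, w z) Ω

/-- The asymptotic rooftop `P[φ](ψ) = lim*_{C→∞} P(ψ, φ+C)`. -/
def asympRooftop (ψ φ : E → EReal) (Ω : Set E) : E → EReal :=
  uscReg (fun z => ⨆ C : ℝ, Rooftop ψ (fun x => φ x + (C : EReal)) Ω z) Ω

/-- The unbounded locus `L(φ)` of `φ` in `Ω`: points of `Ω` having no neighborhood on
which `φ` is bounded. -/
def Lset (φ : E → EReal) (Ω : Set E) : Set E :=
  {a | a ∈ Ω ∧ ∀ U ∈ nhds a, ¬ ∃ M : ℝ, ∀ x ∈ U ∩ Ω, -(M : EReal) ≤ φ x ∧ φ x ≤ (M : EReal)}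

/-- The boundary unbounded locus `BL(φ)`: boundary points near which `φ` is unbounded. -/
def BLset (φ : E → EReal) (Ω : Set E) : Set E :=
  {b | b ∈ frontier Ω ∧
    ∀ U ∈ nhds b, ¬ ∃ M : ℝ, ∀ x ∈ U ∩ Ω, -(M : EReal) ≤ φ x ∧ φ x ≤ (M : EReal)}

/-- `PSH_s⁻(Ω)` : negative psh functions with small unbounded locus (both `L(φ)` and
`BL(φ)` pluripolar). -/
def PSHs (φ : E → EReal) (Ω : Set E) : Prop :=
  PSHNeg φ Ω ∧ Pluripolar (Lset φ Ω) ∧ Pluripolar (BLset φ Ω)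

/-- `u` is a maximal psh function on the set `U`: it is psh there and for every `G ⋐ U`
and every psh `v` on a neighborhood of `closure G` with `v ≤ u` on `∂G`, one has `v ≤ u`
on `G`. -/
def MaximalOn (u : E → EReal) (U : Set E) : Prop :=
  PlurisubharmonicOn u U ∧
  ∀ G : Set E, IsOpen G → IsCompact (closure G) → closure G ⊆ U →
    ∀ W : Set E, IsOpen W → closure G ⊆ W →
      ∀ v : E → EReal, PlurisubharmonicOn v W →
        (∀ z ∈ frontier G, v z ≤ u z) → ∀ z ∈ G, v z ≤ u z

/-- B-regularity of a domain: every continuous function on the boundary is the boundary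
value of a psh function continuous up to the closure. -/
def BRegular (Ω : Set E) : Prop :=
  ∀ η : E → ℝ, ContinuousOn η (frontier Ω) →
    ∃ u : E → ℝ, PlurisubharmonicOn (fun z => ((u z : ℝ) : EReal)) Ω ∧
      ContinuousOn u (closure Ω) ∧ ∀ ζ ∈ frontier Ω, u ζ = η ζ

/-- Pseudoconvexity: existence of a continuous psh exhaustion function. -/
def Pseudoconvex (Ω : Set E) : Prop :=
  IsOpen Ω ∧ ∃ u : E → ℝ, ContinuousOn u Ω ∧
    PlurisubharmonicOn (fun z => ((u z : ℝ) : EReal)) Ω ∧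
    ∀ c : ℝ, IsCompact {z | z ∈ Ω ∧ u z ≤ c}

/-- Hyperconvexity: existence of a negative psh exhaustion function. -/
def Hyperconvex (Ω : Set E) : Prop :=
  ∃ ρ : E → EReal, PlurisubharmonicOn ρ Ω ∧ (∀ z ∈ Ω, ρ z < 0) ∧
    ∀ c : ℝ, c < 0 →
      IsCompact (closure {z | z ∈ Ω ∧ ρ z ≤ (c : EReal)}) ∧
      closure {z | z ∈ Ω ∧ ρ z ≤ (c : EReal)} ⊆ Ω

/-- `H` is the least maximal psh majorant (`fb φ`) of `φ` on `Ω` (within `PSH⁻(Ω)`). -/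
def IsLeastMaxMajorant (φ H : E → EReal) (Ω : Set E) : Prop :=
  MaximalOn H Ω ∧ (∀ z ∈ Ω, H z ≤ 0) ∧ (∀ z ∈ Ω, φ z ≤ H z) ∧
  ∀ H' : E → EReal, MaximalOn H' Ω → (∀ z ∈ Ω, H' z ≤ 0) → (∀ z ∈ Ω, φ z ≤ H' z) →
    ∀ z ∈ Ω, H z ≤ H' z

/-- Extended-real logarithm, with `log 0 = -∞`. -/
def elog (x : ℝ) : EReal := if x ≤ 0 then (⊥ : EReal) else ((Real.log x : ℝ) : EReal)

end Defs

section MA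

/-- Real second directional derivative `D²u(z)(v,w)`. -/
def reB (n : ℕ) (u : Cn n → ℝ) (z v w : Cn n) : ℝ :=
  fderiv ℝ (fun x => fderiv ℝ u x w) z v

/-- Entry `∂²u/∂z_j∂z̄_k` of the complex Hessian of a (C²) function `u`. -/
def cHessEntry (n : ℕ) (u : Cn n → ℝ) (z : Cn n) (j k : Fin n) : ℂ :=
  (1 / 4 : ℂ) *
    ( ((reB n u z ((Pi.single j (1 : ℂ) : Cn n)) ((Pi.single k (1 : ℂ) : Cn n)) : ℝ) : ℂ)
    + ((reB n u z ((Pi.single j Complex.I : Cn n)) ((Pi.single k Complex.I : Cn n)) : ℝ) : ℂ)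
    + Complex.I *
      ( ((reB n u z ((Pi.single j (1 : ℂ) : Cn n)) ((Pi.single k Complex.I : Cn n)) : ℝ) : ℂ)
      - ((reB n u z ((Pi.single j Complex.I : Cn n)) ((Pi.single k (1 : ℂ) : Cn n)) : ℝ) : ℂ)))

/-- Density of the Monge–Ampère measure `(dd^c u)ⁿ` of a smooth function `u`. -/
def maDensity (n : ℕ) (u : Cn n → ℝ) (z : Cn n) : ℝ :=
  (4 : ℝ) ^ n * (n.factorial : ℝ) * (Matrix.det (Matrix.of fun j k => cHessEntry n u z j k)).re

/-- `μ` is the Bedford–Taylor Monge–Ampère measure `(dd^c u)ⁿ` of `u` on `Ω`: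
it is locally finite on `Ω`, carried by `Ω`, and for every open `U ⊆ Ω` and every
decreasing sequence of smooth psh functions on `U` converging pointwise to `u`, the
corresponding smooth Monge–Ampère measures converge to `μ` against test functions
supported in `U`. -/
def IsMAMeasure (n : ℕ) (u : Cn n → EReal) (Ω : Set (Cn n)) (μ : Measure (Cn n)) : Prop :=
  μ Ωᶜ = 0 ∧ (∀ K : Set (Cn n), IsCompact K → K ⊆ Ω → μ K ≠ ⊤) ∧
  ∀ U : Set (Cn n), IsOpen U → U ⊆ Ω →
    ∀ v : ℕ → Cn n → ℝ,
      (∀ k, ContDiffOn ℝ (⊤ : ℕ∞) (v k) U) →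
      (∀ k, PlurisubharmonicOn (fun z => ((v k z : ℝ) : EReal)) U) →
      (∀ k, ∀ z ∈ U, v (k + 1) z ≤ v k z) →
      (∀ z ∈ U, (⨅ k, ((v k z : ℝ) : EReal)) = u z) →
      ∀ f : Cn n → ℝ, Continuous f → HasCompactSupport f → tsupport f ⊆ U →
        Filter.Tendsto (fun k => ∫ z, f z * maDensity n (v k) z) Filter.atTop
          (nhds (∫ z, f z ∂μ))

/-- The Cegrell class `E₀(Ω)`: bounded negative psh functions with zero boundary values
and finite total Monge–Ampère mass. -/
def ClassE0 (n : ℕ) (Ω : Set (Cn n)) (φ : Cn n → EReal) : Prop :=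
  PSHNeg φ Ω ∧ (∃ M : ℝ, ∀ z ∈ Ω, -(M : EReal) ≤ φ z) ∧
  (∀ ζ ∈ frontier Ω, Filter.Tendsto φ (nhdsWithin ζ Ω) (nhds (0 : EReal))) ∧
  ∃ μ : Measure (Cn n), IsMAMeasure n φ Ω μ ∧ μ Ω ≠ ⊤

/-- The Cegrell class `E(Ω)`: negative psh functions that are locally decreasing limits
of functions of `E₀(Ω)` with uniformly bounded total Monge–Ampère masses. -/
def ClassE (n : ℕ) (Ω : Set (Cn n)) (φ : Cn n → EReal) : Prop :=
  PSHNeg φ Ω ∧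
  ∀ z ∈ Ω, ∃ U : Set (Cn n), IsOpen U ∧ z ∈ U ∧ U ⊆ Ω ∧
    ∃ h : ℕ → Cn n → EReal, ∃ M : ℝ≥0∞, M ≠ ⊤ ∧
      (∀ j, ClassE0 n Ω (h j)) ∧
      (∀ j, ∀ x ∈ Ω, h (j + 1) x ≤ h j x) ∧
      (∀ x ∈ U, (⨅ j, h j x) = φ x) ∧
      (∀ j, ∀ μ : Measure (Cn n), IsMAMeasure n (h j) Ω μ → μ Ω ≤ M)

/-- The Cegrell class `N(Ω) = {w ∈ E(Ω) : fb w = 0}`. -/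
def ClassN (n : ℕ) (Ω : Set (Cn n)) : Set (Cn n → EReal) :=
  {w | ClassE n Ω w ∧ IsLeastMaxMajorant w 0 Ω}

/-- The Cegrell class `F(Ω) = {w ∈ E(Ω) : ∫ (dd^c w)ⁿ < ∞ and fb w = 0}`. -/
def ClassF (n : ℕ) (Ω : Set (Cn n)) : Set (Cn n → EReal) :=
  {w | ClassE n Ω w ∧ IsLeastMaxMajorant w 0 Ω ∧
    ∀ μ : Measure (Cn n), IsMAMeasure n w Ω μ → μ Ω ≠ ⊤}

/-- Membership `φ ∈ K(Ω, H)`: `φ ∈ E(Ω)` and `H + w ≤ φ ≤ H` for some `w ∈ K`. -/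
def InClassRel (n : ℕ) (Ω : Set (Cn n)) (K : Set (Cn n → EReal)) (H φ : Cn n → EReal) : Prop :=
  ClassE n Ω φ ∧ ∃ w ∈ K, ∀ z ∈ Ω, H z + w z ≤ φ z ∧ φ z ≤ H z

/-- The annulus `A = {1 < |ζ| < e}`. -/
def annA : Set ℂ := {ζ : ℂ | 1 < ‖ζ‖ ∧ ‖ζ‖ < Real.exp 1}

/-- The class `W(u₀,u₁)` of subgeodesics: negative psh functions on `Ω × A` with boundary
limsups dominated by `u₀` on `|ζ| = 1` and by `u₁` on `|ζ| = e`. -/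
def geodClass (n : ℕ) (Ω : Set (Cn n)) (u0 u1 : Cn n → EReal) : Set (Cn n × ℂ → EReal) :=
  {u | PSHNeg u (Ω ×ˢ annA) ∧
    (∀ z ∈ Ω, Filter.limsup (fun ζ : ℂ => u (z, ζ))
        ((nhds (1 : ℝ)).comap (fun ζ : ℂ => ‖ζ‖) ⊓ Filter.principal annA) ≤ u0 z) ∧
    (∀ z ∈ Ω, Filter.limsup (fun ζ : ℂ => u (z, ζ))
        ((nhds (Real.exp 1)).comap (fun ζ : ℂ => ‖ζ‖) ⊓ Filter.principal annA) ≤ u1 z)}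

/-- The geodesic `u_t(z) = P_W(z, e^t)`, the Perron envelope of the class `W(u₀,u₁)`. -/
def geodesic (n : ℕ) (Ω : Set (Cn n)) (u0 u1 : Cn n → EReal) (t : ℝ) (z : Cn n) : EReal :=
  ⨆ u ∈ geodClass n Ω u0 u1, u (z, ((Real.exp t : ℝ) : ℂ))

/-- The Monge–Ampère capacity `Cap(S) = sup {∫_S (dd^c u)ⁿ : u psh, -1 ≤ u ≤ 0}`. -/
def MACap (n : ℕ) (Ω : Set (Cn n)) (S : Set (Cn n)) : ℝ≥0∞ :=
  ⨆ u ∈ {u : Cn n → EReal | PlurisubharmonicOn u Ω ∧ ∀ z ∈ Ω, -1 ≤ u z ∧ u z ≤ 0},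
    ⨆ μ ∈ {μ : Measure (Cn n) | IsMAMeasure n u Ω μ}, μ S

/-- Convergence `u t → g` in capacity as `t → t₀` within `(0,1)`. -/
def TendstoInCap (n : ℕ) (Ω : Set (Cn n)) (u : ℝ → Cn n → EReal) (g : Cn n → EReal)
    (t0 : ℝ) : Prop :=
  ∀ ε : ℝ, 0 < ε → ∀ K : Set (Cn n), IsCompact K → K ⊆ Ω →
    Filter.Tendsto
      (fun t => MACap n Ω
        {z | z ∈ K ∧ ¬ (u t z ≤ g z + (ε : EReal) ∧ g z ≤ u t z + (ε : EReal))})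
      (nhdsWithin t0 (Set.Ioo (0 : ℝ) 1)) (nhds (0 : ℝ≥0∞))

/-- Convergence `u t → g` in `L¹_loc(Ω)` as `t → t₀` within `(0,1)`. -/
def TendstoL1loc (n : ℕ) (Ω : Set (Cn n)) (u : ℝ → Cn n → EReal) (g : Cn n → EReal)
    (t0 : ℝ) : Prop :=
  ∀ K : Set (Cn n), IsCompact K → K ⊆ Ω →
    Filter.Tendsto (fun t => ∫⁻ z in K, ENNReal.ofReal |(u t z).toReal - (g z).toReal|)
      (nhdsWithin t0 (Set.Ioo (0 : ℝ) 1)) (nhds (0 : ℝ≥0∞))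

end MA

section Plurisubharmonic

variable {E : Type*} [NormedAddCommGroup E] [NormedSpace ℂ E]

/-- The maximum principle on closed discs of complex lines in `Ω`, without semicontinuity. -/
def DiscMaxPrinciple (u : E → EReal) (Ω : Set E) : Prop :=
  ∀ a b : E, ∀ r : ℝ, 0 < r →
    (∀ ζ : ℂ, ‖ζ‖ ≤ r → a + ζ • b ∈ Ω) →
    ∀ p : Polynomial ℂ,
      (∀ ζ : ℂ, ‖ζ‖ = r → u (a + ζ • b) ≤ ((Polynomial.eval ζ p).re : EReal)) →
      ∀ ζ : ℂ, ‖ζ‖ ≤ r → u (a + ζ • b) ≤ ((Polynomial.eval ζ p).re : EReal)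

theorem DiscMaxPrinciple.iSup {ι : Sort*} {u : ι → E → EReal} {Ω : Set E}
    (h : ∀ i, DiscMaxPrinciple (u i) Ω) : DiscMaxPrinciple (fun z => ⨆ i, u i z) Ω :=
  fun a b r hr hd p hp ζ hζ => iSup_le fun i =>
    h i a b r hr hd p (fun ξ hξ => (le_iSup (fun i => u i (a + ξ • b)) i).trans (hp ξ hξ)) ζ hζ

theorem EReal.le_coe_of_forall_pos_le_add {x : EReal} {c : ℝ}
    (h : ∀ ε : ℝ, 0 < ε → x ≤ ((c + ε : ℝ) : EReal)) : x ≤ c := by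
  refine EReal.le_of_forall_lt_iff_le.1 fun z hz => ?_
  have hz' : c < z := by exact_mod_cast hz
  simpa using h (z - c) (by linarith)

theorem upperSemicontinuousOn_uscReg {E : Type*} [NormedAddCommGroup E] (f : E → EReal) (Ω : Set E) :
    UpperSemicontinuousOn (uscReg f Ω) Ω := by
  intro z _ y hy
  obtain ⟨y', h1, h2⟩ := exists_between hy
  have := eventually_lt_of_limsup_lt h1
  filter_upwards [eventually_eventually_nhdsWithin.2 this] with x hx
  exact (limsup_le_of_le (by isBoundedDefault) (hx.mono fun _ h => h.le)).trans_lt h2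

theorem le_uscReg {E : Type*} [NormedAddCommGroup E] (f : E → EReal) {Ω : Set E} {z : E} (hz : z ∈ Ω) : f z ≤ uscReg f Ω z := by
  refine le_of_forall_gt fun c hc => ?_
  obtain ⟨c', h1, h2⟩ := exists_between hc
  exact ((eventually_lt_of_limsup_lt h1).self_of_nhdsWithin hz).trans h2

theorem uscReg_le {E : Type*} [NormedAddCommGroup E] {f g : E → EReal} {Ω : Set E} (hg : UpperSemicontinuousOn g Ω)
    (h : ∀ x ∈ Ω, f x ≤ g x) {z : E} (hz : z ∈ Ω) : uscReg f Ω z ≤ g z := by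
  refine le_of_forall_gt_imp_ge_of_dense fun c hc => ?_
  refine limsup_le_of_le (by isBoundedDefault) ?_
  filter_upwards [hg z hz c hc, self_mem_nhdsWithin] with x hx hxΩ
  exact (h x hxΩ).trans hx.le

theorem UpperSemicontinuousOn.upperSemicontinuousAt {α β : Type*} [TopologicalSpace α]
    [Preorder β] {f : α → β} {s : Set α} (hf : UpperSemicontinuousOn f s) (hs : IsOpen s) {x : α}
    (hx : x ∈ s) : UpperSemicontinuousAt f x := fun y hy => by
  have := hf x hx y hy
  rwa [hs.nhdsWithin_eq hx] at this

/-- The usc regularization of a function satisfying the maximum principle on discs is psh. -/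
theorem DiscMaxPrinciple.uscReg {f : E → EReal} {Ω : Set E} (hΩ : IsOpen Ω)
    (hf : DiscMaxPrinciple f Ω) : PlurisubharmonicOn (uscReg f Ω) Ω := by
  refine ⟨upperSemicontinuousOn_uscReg f Ω, fun a b r hr hd p hp ζ₀ hζ₀ => ?_⟩
  refine EReal.le_coe_of_forall_pos_le_add fun ε hε => ?_
  have hdisc : ∀ᶠ a' in 𝓝 a, ∀ ζ ∈ Metric.closedBall (0 : ℂ) r, a' + ζ • b ∈ Ω := by
    refine (isCompact_closedBall (0 : ℂ) r).eventually_forall_of_forall_eventually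
      fun ζ hζ => ?_
    have hc : ContinuousAt (fun q : E × ℂ => q.1 + q.2 • b) (a, ζ) := by fun_prop
    exact hc.eventually_mem (hΩ.mem_nhds (hd ζ (by simpa using hζ)))
  have hcircle : ∀ᶠ a' in 𝓝 a, ∀ ζ ∈ Metric.sphere (0 : ℂ) r,
      _root_.uscReg f Ω (a' + ζ • b) < ((((Polynomial.eval ζ p).re + ε : ℝ)) : EReal) := by
    refine (isCompact_sphere (0 : ℂ) r).eventually_forall_of_forall_eventually
      fun ζ hζ => ?_
    have hζr : ‖ζ‖ = r := by simpa using hζ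
    have h1 : _root_.uscReg f Ω (a + ζ • b) < (((Polynomial.eval ζ p).re + ε / 2 : ℝ) : EReal) :=
      (hp ζ hζr).trans_lt (by exact_mod_cast (by linarith))
    have hc : ContinuousAt (fun q : E × ℂ => q.1 + q.2 • b) (a, ζ) := by fun_prop
    have h2 := hc.eventually (((upperSemicontinuousOn_uscReg f Ω).upperSemicontinuousAt hΩ
      (hd ζ hζr.le)) _ h1)
    have hc2 : ContinuousAt (fun q : E × ℂ => (Polynomial.eval q.2 p).re + ε) (a, ζ) := by
      fun_prop
    have h3 := hc2.eventually (lt_mem_nhds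
      (show (Polynomial.eval ζ p).re + ε / 2 < (Polynomial.eval ζ p).re + ε by linarith))
    filter_upwards [h2, h3] with q hq2 hq3
    exact hq2.trans (by exact_mod_cast hq3)
  have key : ∀ᶠ a' in 𝓝 a,
      f (a' + ζ₀ • b) ≤ ((((Polynomial.eval ζ₀ p).re + ε : ℝ)) : EReal) := by
    filter_upwards [hdisc, hcircle] with a' h1 h2
    have := hf a' b r hr (fun ζ hζ => h1 ζ (by simpa using hζ)) (p + Polynomial.C (ε : ℂ))
      (fun ζ hζ => ?_) ζ₀ hζ₀
    · simpa using this
    · refine (le_uscReg f (h1 ζ (by simpa using hζ.le))).trans ?_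
      simpa using (h2 ζ (by simpa using hζ)).le
  have ht : Tendsto (fun x => x - ζ₀ • b) (𝓝 (a + ζ₀ • b)) (𝓝 a) := by
    have : ContinuousAt (fun x => x - ζ₀ • b) (a + ζ₀ • b) := by fun_prop
    simpa [ContinuousAt] using this
  refine limsup_le_of_le (by isBoundedDefault) ?_
  filter_upwards [nhdsWithin_le_nhds (ht.eventually key)] with x hx
  simpa using hx

theorem plurisubharmonicOn_PEnv {Ω : Set E} (hΩ : IsOpen Ω) (h : E → EReal) :
    PlurisubharmonicOn (PEnv h Ω) Ω :=
  DiscMaxPrinciple.uscReg hΩ <| DiscMaxPrinciple.iSup fun _ =>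
    DiscMaxPrinciple.iSup fun hv => hv.1.2

theorem PEnv_le {Ω : Set E} {h : E → EReal} (hh : UpperSemicontinuousOn h Ω) {z : E}
    (hz : z ∈ Ω) : PEnv h Ω z ≤ h z :=
  uscReg_le hh (fun x hx => iSup₂_le fun _ hv => hv.2 x hx) hz

theorem le_PEnv {Ω : Set E} {h v : E → EReal} (hv : PlurisubharmonicOn v Ω)
    (hvh : ∀ x ∈ Ω, v x ≤ h x) {z : E} (hz : z ∈ Ω) : v z ≤ PEnv h Ω z := by
  unfold PEnv
  refine le_trans ?_ (le_uscReg _ hz)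
  exact le_iSup₂_of_le v ⟨hv, hvh⟩ le_rfl

theorem upperSemicontinuousOn_add_coe {E : Type*} [NormedAddCommGroup E] {Ω : Set E} {u : E → EReal}
    (hu : UpperSemicontinuousOn u Ω) (C : ℝ) :
    UpperSemicontinuousOn (fun x => u x + (C : EReal)) Ω :=
  hu.add' upperSemicontinuousOn_const fun _ _ => EReal.continuousAt_add (by simp) (by simp)

theorem EReal.coe_mul_le_iff {c : ℝ} (hc : 0 < c) {x y : EReal} :
    (c : EReal) * x ≤ y ↔ x ≤ ((c⁻¹ : ℝ) : EReal) * y := by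
  rw [EReal.coe_inv, ← EReal.div_eq_inv_mul, mul_comm,
    EReal.le_div_iff_mul_le (by exact_mod_cast hc) (EReal.coe_ne_top c)]

theorem PlurisubharmonicOn.const_mul {Ω : Set E} {u : E → EReal}
    (hu : PlurisubharmonicOn u Ω) {c : ℝ} (hc : 0 < c) :
    PlurisubharmonicOn (fun x => (c : EReal) * u x) Ω := by
  refine ⟨?_, fun a b r hr hd p hp ζ hζ => ?_⟩
  · have hcont : Continuous fun x : EReal => (c : EReal) * x :=
      continuous_iff_continuousAt.2 fun x =>
        ContinuousAt.comp (f := fun x : EReal => ((c : EReal), x)) (EReal.continuousAt_mul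
          (by simp [hc.ne']) (by simp [hc.ne']) (by simp) (by simp)) (by fun_prop)
    exact hcont.comp_upperSemicontinuousOn hu.1
      fun x y hxy => mul_le_mul_of_nonneg_left hxy (by exact_mod_cast hc.le)
  · have key : ∀ ξ : ℂ, (c : EReal) * u (a + ξ • b) ≤ ((p.eval ξ).re : EReal) ↔
        u (a + ξ • b) ≤ (((Polynomial.C ((c⁻¹ : ℝ) : ℂ) * p).eval ξ).re : EReal) := fun ξ => by
      rw [EReal.coe_mul_le_iff hc, Polynomial.eval_mul, Polynomial.eval_C, Complex.re_ofReal_mul,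
        EReal.coe_mul]
    exact (key ζ).2 (hu.2 a b r hr hd _ (fun ξ hξ => (key ξ).1 (hp ξ hξ)) ζ hζ)

end Plurisubharmonic
section Circle

open Polynomial in
theorem exists_polynomial_re_eq_of_mem_span_fourier {f : C(UnitAddCircle, ℂ)}
    (hf : f ∈ Submodule.span ℂ (Set.range (fourier (T := 1)))) :
    ∃ p : ℂ[X], ∀ t, (f t).re = (p.eval (AddCircle.toCircle t : ℂ)).re := by
  suffices ∀ c : ℂ, ∃ p : ℂ[X], ∀ t, (c * f t).re = (p.eval (AddCircle.toCircle t : ℂ)).re by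
    simpa using this 1
  induction hf using Submodule.span_induction with
  | mem x hx =>
    obtain ⟨n, rfl⟩ := hx
    intro c
    obtain ⟨m, rfl | rfl⟩ := n.eq_nat_or_neg
    · exact ⟨C c * X ^ m, fun t => by simp [fourier_apply, AddCircle.toCircle_nsmul]⟩
    · refine ⟨C (starRingEnd ℂ c) * X ^ m, fun t => ?_⟩
      rw [fourier_neg, ← Complex.conj_re]
      simp [fourier_apply, AddCircle.toCircle_nsmul]
  | zero => exact fun c => ⟨0, by simp⟩
  | add x y _ _ hx hy =>
    intro c
    obtain ⟨p, hp⟩ := hx c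
    obtain ⟨q, hq⟩ := hy c
    exact ⟨p + q, fun t => by simp [mul_add, hp, hq]⟩
  | smul a x _ hx =>
    intro c
    obtain ⟨p, hp⟩ := hx (c * a)
    exact ⟨p, fun t => by simpa [mul_assoc] using hp t⟩

theorem exists_polynomial_re_near (h : C(UnitAddCircle, ℝ)) {ε : ℝ} (hε : 0 < ε) :
    ∃ p : Polynomial ℂ, ∀ t, |(p.eval (AddCircle.toCircle t : ℂ)).re - h t| < ε := by
  let g : C(UnitAddCircle, ℂ) := ⟨fun t => (h t : ℂ), by fun_prop⟩
  have hg : g ∈ (Submodule.span ℂ (Set.range (fourier (T := 1)))).topologicalClosure := by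
    rw [span_fourier_closure_eq_top]; trivial
  obtain ⟨f, hf, hfg⟩ := Metric.mem_closure_iff.1 hg ε hε
  obtain ⟨p, hp⟩ := exists_polynomial_re_eq_of_mem_span_fourier hf
  refine ⟨p, fun t => ?_⟩
  rw [← hp, abs_sub_comm]
  calc |h t - (f t).re| = |(g t - f t).re| := by simp [g]
    _ ≤ ‖g t - f t‖ := Complex.abs_re_le_norm _
    _ = dist (g t) (f t) := (dist_eq_norm _ _).symm
    _ ≤ dist g f := ContinuousMap.dist_apply_le_dist t
    _ < ε := hfg

/-- Two usc functions whose sum is less than a continuous function can be separated by a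
continuous function. -/
theorem exists_continuous_separation {X : Type*} [TopologicalSpace X] [NormalSpace X]
    [ParacompactSpace X] {u v : X → EReal} {f : X → ℝ}
    (hu : UpperSemicontinuous u) (hv : UpperSemicontinuous v) (hf : Continuous f)
    (hut : ∀ x, u x < ⊤) (hvt : ∀ x, v x < ⊤) (h : ∀ x, u x + v x < (f x : EReal)) :
    ∃ g : C(X, ℝ), ∀ x, u x < (g x : EReal) ∧ v x < ((f x - g x : ℝ) : EReal) := by
  refine exists_continuous_forall_mem_convex_of_local_const
    (t := fun x => {c : ℝ | u x < (c : EReal) ∧ v x < ((f x - c : ℝ) : EReal)})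
    (fun x => Set.OrdConnected.convex ⟨?_⟩) fun x => ?_
  · rintro a ⟨ha, _⟩ b ⟨_, hb⟩ c ⟨hac, hcb⟩
    exact ⟨ha.trans_le (by exact_mod_cast hac),
      hb.trans_le (by exact_mod_cast (by linarith))⟩
  · have : ∃ c d : ℝ, u x < (c : EReal) ∧ v x < (d : EReal) ∧ c + d < f x := by
      have hux := hut x
      have hvx := hvt x
      have hx := h x
      generalize u x = U at *
      generalize v x = V at *
      induction U with
      | top => simp at hux
      | bot =>
        obtain ⟨d, hd, _⟩ := EReal.lt_iff_exists_real_btwn.1 hvx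
        exact ⟨f x - d - 1, d, EReal.bot_lt_coe _, hd, by linarith⟩
      | coe c =>
        induction V with
        | top => simp at hvx
        | bot => exact ⟨c + 1, f x - c - 2, by exact_mod_cast (by linarith),
            EReal.bot_lt_coe _, by linarith⟩
        | coe d =>
          have hx' : c + d < f x := by exact_mod_cast hx
          exact ⟨c + (f x - c - d) / 3, d + (f x - c - d) / 3,
            by exact_mod_cast (by linarith), by exact_mod_cast (by linarith), by linarith⟩
    obtain ⟨c, d, hc, hd, hcd⟩ := this
    refine ⟨c, ?_⟩
    filter_upwards [hu x _ hc, hv x _ hd,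
      hf.continuousAt.eventually (lt_mem_nhds hcd)] with y h1 h2 h3
    exact ⟨h1, h2.trans (by exact_mod_cast (by linarith))⟩

theorem exists_polynomial_separation {u v : UnitAddCircle → EReal} {f : UnitAddCircle → ℝ}
    (hu : UpperSemicontinuous u) (hv : UpperSemicontinuous v) (hf : Continuous f)
    (hut : ∀ x, u x < ⊤) (hvt : ∀ x, v x < ⊤) (h : ∀ x, u x + v x < (f x : EReal))
    {ε : ℝ} (hε : 0 < ε) :
    ∃ p : Polynomial ℂ, ∀ t, u t < (((p.eval (AddCircle.toCircle t : ℂ)).re : ℝ) : EReal) ∧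
      v t < ((f t + ε - (p.eval (AddCircle.toCircle t : ℂ)).re : ℝ) : EReal) := by
  obtain ⟨g, hg⟩ := exists_continuous_separation hu hv hf hut hvt h
  obtain ⟨p, hp⟩ := exists_polynomial_re_near (g + .const _ (ε / 2)) (half_pos hε)
  refine ⟨p, fun t => ?_⟩
  have := abs_lt.1 (hp t)
  simp only [ContinuousMap.add_apply, ContinuousMap.const_apply] at this
  exact ⟨(hg t).1.trans (by exact_mod_cast (by linarith)),
    (hg t).2.trans (by exact_mod_cast (by linarith))⟩

theorem integral_eval_toCircle (p : Polynomial ℂ) :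
    ∫ t : UnitAddCircle, p.eval (AddCircle.toCircle t : ℂ) ∂AddCircle.haarAddCircle =
      p.eval 0 := by
  induction p using Polynomial.induction_on' with
  | add p q hp hq =>
    have hi : ∀ p : Polynomial ℂ, Integrable
        (fun t : UnitAddCircle => p.eval (AddCircle.toCircle t : ℂ)) AddCircle.haarAddCircle :=
      fun p => Continuous.integrable_of_hasCompactSupport
        (p.continuous.comp (continuous_subtype_val.comp AddCircle.continuous_toCircle))
        (HasCompactSupport.of_compactSpace _)
    simp only [Polynomial.eval_add]
    rw [integral_add (hi p) (hi q), hp, hq]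
  | monomial n c =>
    simp only [Polynomial.eval_monomial]
    rw [integral_const_mul]
    rcases eq_or_ne n 0 with rfl | hn
    · simp
    · have h0 : ∫ t : UnitAddCircle, (fourier (n : ℤ) t : ℂ) ∂AddCircle.haarAddCircle = 0 :=
        integral_eq_zero_of_add_right_eq_neg
          (fourier_add_half_inv_index (by exact_mod_cast hn) one_pos)
      have h1 : ∀ t : UnitAddCircle, (AddCircle.toCircle t : ℂ) ^ n = fourier (n : ℤ) t :=
        fun t => by simp [fourier_apply, AddCircle.toCircle_nsmul]
      simp only [h1, h0, zero_pow hn]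

theorem exists_toCircle_eq {ζ : ℂ} (hζ : ‖ζ‖ = 1) :
    ∃ t : UnitAddCircle, (AddCircle.toCircle t : ℂ) = ζ := by
  obtain ⟨t, ht⟩ := (AddCircle.homeomorphCircle (T := 1) one_ne_zero).surjective
    ⟨ζ, mem_sphere_zero_iff_norm.2 hζ⟩
  exact ⟨t, by rw [← AddCircle.homeomorphCircle_apply one_ne_zero, ht]⟩

variable {E : Type*} [NormedAddCommGroup E] [NormedSpace ℂ E]

theorem upperSemicontinuous_comp_circle {Ω : Set E} {u : E → EReal}
    (hu : UpperSemicontinuousOn u Ω) (a b : E) (r : ℝ)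
    (h : ∀ ζ : ℂ, ‖ζ‖ = |r| → a + ζ • b ∈ Ω) :
    UpperSemicontinuous fun t : UnitAddCircle =>
      u (a + ((r : ℂ) * (AddCircle.toCircle t : ℂ)) • b) := by
  rw [← upperSemicontinuousOn_univ_iff]
  have hc : Continuous fun t : UnitAddCircle => (AddCircle.toCircle t : ℂ) :=
    continuous_subtype_val.comp AddCircle.continuous_toCircle
  exact hu.comp (g := fun t : UnitAddCircle => a + ((r : ℂ) * (AddCircle.toCircle t : ℂ)) • b)
    (by fun_prop) fun t _ => h _ (by simp [Circle.norm_coe (AddCircle.toCircle t)])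

/-- The sum of two negative psh functions is psh. -/
theorem PSHNeg.add {Ω : Set E} {u v : E → EReal} (hu : PSHNeg u Ω) (hv : PSHNeg v Ω) :
    PSHNeg (fun x => u x + v x) Ω := by
  have hlt : ∀ {w : E → EReal}, PSHNeg w Ω → ∀ x ∈ Ω, w x < ⊤ :=
    fun hw x hx => (hw.2 x hx).trans_lt EReal.zero_lt_top
  refine ⟨⟨hu.1.1.add' hv.1.1 fun x hx => EReal.continuousAt_add
    (.inl (hlt hu x hx).ne) (.inr (hlt hv x hx).ne), fun a b r hr hd p hp ζ hζ => ?_⟩,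
    fun x hx => add_nonpos (hu.2 x hx) (hv.2 x hx)⟩
  refine EReal.le_coe_of_forall_pos_le_add fun ε hε => ?_
  have hc : Continuous fun t : UnitAddCircle => (AddCircle.toCircle t : ℂ) :=
    continuous_subtype_val.comp AddCircle.continuous_toCircle
  have hsph : ∀ ξ : ℂ, ‖ξ‖ = |r| → a + ξ • b ∈ Ω := fun ξ hξ =>
    hd ξ (by rw [hξ, abs_of_pos hr])
  have hnorm : ∀ t : UnitAddCircle, ‖(r : ℂ) * (AddCircle.toCircle t : ℂ)‖ = r := fun t => by
    simp [Circle.norm_coe (AddCircle.toCircle t), abs_of_pos hr]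
  obtain ⟨q, hq⟩ := exists_polynomial_separation (ε := ε / 2)
    (f := fun t => (p.eval ((r : ℂ) * (AddCircle.toCircle t : ℂ))).re + ε / 2)
    (upperSemicontinuous_comp_circle hu.1.1 a b r hsph)
    (upperSemicontinuous_comp_circle hv.1.1 a b r hsph) (by fun_prop)
    (fun t => hlt hu _ (hd _ (hnorm t).le)) (fun t => hlt hv _ (hd _ (hnorm t).le))
    (fun t => (hp _ (hnorm t)).trans_lt (by exact_mod_cast (by linarith))) (half_pos hε)
  set q' : Polynomial ℂ := q.comp (Polynomial.C ((r : ℂ)⁻¹) * Polynomial.X) with hq'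
  have hr0 : (r : ℂ) ≠ 0 := by exact_mod_cast hr.ne'
  have hq'_eval : ∀ t : UnitAddCircle, q'.eval ((r : ℂ) * (AddCircle.toCircle t : ℂ)) =
      q.eval (AddCircle.toCircle t : ℂ) := fun t => by
    simp [hq', Polynomial.eval_comp, inv_mul_cancel_left₀ hr0]
  have hpar : ∀ ξ : ℂ, ‖ξ‖ = r →
      ∃ t : UnitAddCircle, (r : ℂ) * (AddCircle.toCircle t : ℂ) = ξ := fun ξ hξ => by
    obtain ⟨t, ht⟩ := exists_toCircle_eq (ζ := (r : ℂ)⁻¹ * ξ)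
      (by simp [hξ, abs_of_pos hr, hr.ne'])
    exact ⟨t, by rw [ht, mul_inv_cancel_left₀ hr0]⟩
  have h1 : u (a + ζ • b) ≤ ((q'.eval ζ).re : EReal) := by
    refine hu.1.2 a b r hr hd q' (fun ξ hξ => ?_) ζ hζ
    obtain ⟨t, rfl⟩ := hpar ξ hξ
    rw [hq'_eval]
    exact (hq t).1.le
  have h2 : v (a + ζ • b) ≤ (((p + Polynomial.C (ε : ℂ) - q').eval ζ).re : EReal) := by
    refine hv.1.2 a b r hr hd _ (fun ξ hξ => ?_) ζ hζ
    obtain ⟨t, rfl⟩ := hpar ξ hξ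
    refine (hq t).2.le.trans ?_
    rw [Polynomial.eval_sub, hq'_eval]
    simp only [Polynomial.eval_add, Polynomial.eval_C, Complex.sub_re, Complex.add_re,
      Complex.ofReal_re]
    exact_mod_cast (by linarith)
  refine (add_le_add h1 h2).trans ?_
  simp only [Polynomial.eval_sub, Polynomial.eval_add, Polynomial.eval_C, Complex.sub_re,
    Complex.add_re, Complex.ofReal_re]
  exact_mod_cast (by linarith)

end Circle
section MeanValue

open scoped NNReal

/-- Sub-mean value property on circles, in terms of the nonnegative function `-w`. -/
theorem PSHNeg.lintegral_circle_le {E : Type*} [NormedAddCommGroup E] [NormedSpace ℂ E]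
    {Ω : Set E} {w : E → EReal} (hw : PSHNeg w Ω) (a b : E)
    (hd : ∀ ζ : ℂ, ‖ζ‖ ≤ 1 → a + ζ • b ∈ Ω) :
    ∫⁻ t : UnitAddCircle, (-w (a + (AddCircle.toCircle t : ℂ) • b)).toENNReal
      ∂AddCircle.haarAddCircle ≤ (-w a).toENNReal := by
  have hnorm : ∀ t : UnitAddCircle, ‖(AddCircle.toCircle t : ℂ)‖ = 1 :=
    fun t => Circle.norm_coe _
  rw [lintegral_eq_nnreal]
  refine iSup₂_le fun s hs => ?_
  refine ENNReal.le_of_forall_pos_le_add fun ε hε _ => ?_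
  have hε' : (0 : ℝ) < ε := hε
  have hsfin : ∫⁻ t, (s t : ℝ≥0∞) ∂(AddCircle.haarAddCircle (T := 1)) ≠ ∞ := by
    obtain ⟨C, hC⟩ := s.exists_forall_le
    refine ((lintegral_mono (g := fun _ => (C : ℝ≥0∞)) fun t => ?_).trans_lt ?_).ne
    · exact ENNReal.coe_le_coe.2 (hC t)
    · simp
  obtain ⟨g, hgs, hg, hgint⟩ := SimpleFunc.exists_upperSemicontinuous_le_lintegral_le s hsfin
    (ε := ENNReal.ofReal (ε / 3)) (by simpa using hε)
  have hu := upperSemicontinuous_comp_circle hw.1.1 a b 1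
    (fun ζ hζ => hd ζ (by simpa using hζ.le))
  simp only [Complex.ofReal_one, one_mul] at hu
  have hv : UpperSemicontinuous fun t => ((g t : ℝ) : EReal) :=
    Continuous.comp_upperSemicontinuous (g := fun y : ℝ≥0 => ((y : ℝ) : EReal))
      (continuous_coe_real_ereal.comp NNReal.continuous_coe) hg
      fun x y hxy => EReal.coe_le_coe_iff.2 hxy
  have hsum : ∀ t : UnitAddCircle, w (a + (AddCircle.toCircle t : ℂ) • b) + ((g t : ℝ) : EReal) <
      ((ε / 3 : ℝ) : EReal) := fun t => by
    have hwt := hw.2 _ (hd _ (hnorm t).le)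
    have h1 : ((g t : ℝ≥0∞)) ≤ (-w (a + (AddCircle.toCircle t : ℂ) • b)).toENNReal :=
      le_trans (by exact_mod_cast hgs t) (hs t)
    have h2 : ((g t : ℝ) : EReal) ≤ -w (a + (AddCircle.toCircle t : ℂ) • b) := by
      rw [← EReal.coe_toENNReal (EReal.neg_nonneg.2 hwt)]
      exact EReal.coe_ennreal_le_coe_ennreal_iff.2 h1
    refine (add_le_add_right h2 _).trans_lt ?_
    refine lt_of_le_of_lt ?_ (show (0 : EReal) < ((ε / 3 : ℝ) : EReal) by
      exact_mod_cast (by positivity))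
    rw [← sub_eq_add_neg]
    exact EReal.sub_self_le_zero
  obtain ⟨q, hq⟩ := exists_polynomial_separation (f := fun _ => (ε : ℝ) / 3) (ε := (ε : ℝ) / 3)
    hu hv continuous_const
    (fun t => (hw.2 _ (hd _ (hnorm t).le)).trans_lt EReal.zero_lt_top)
    (fun t => EReal.coe_lt_top _) hsum (by positivity)
  have hwa : w a ≤ ((q.eval 0).re : EReal) := by
    have := hw.1.2 a b 1 one_pos hd q (fun ζ hζ => ?_) 0 (by simp)
    · simpa using this
    · obtain ⟨t, rfl⟩ := exists_toCircle_eq hζ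
      exact (hq t).1.le
  have hcq : Continuous fun t : UnitAddCircle => q.eval (AddCircle.toCircle t : ℂ) :=
    q.continuous.comp (continuous_subtype_val.comp AddCircle.continuous_toCircle)
  have hiq : Integrable (fun t : UnitAddCircle => q.eval (AddCircle.toCircle t : ℂ))
      AddCircle.haarAddCircle :=
    hcq.integrable_of_hasCompactSupport (HasCompactSupport.of_compactSpace _)
  have hireq : Integrable (fun t : UnitAddCircle => (q.eval (AddCircle.toCircle t : ℂ)).re)
      AddCircle.haarAddCircle := hiq.re
  have hre : ∫ t : UnitAddCircle, (q.eval (AddCircle.toCircle t : ℂ)).re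
      ∂AddCircle.haarAddCircle = (q.eval 0).re := by
    rw [← integral_eval_toCircle q]
    exact Complex.reCLM.integral_comp_comm hiq
  have hgq : ∀ t : UnitAddCircle,
      (g t : ℝ) < ε / 3 + ε / 3 - (q.eval (AddCircle.toCircle t : ℂ)).re := fun t => by
    exact_mod_cast (hq t).2
  have hgle : ∫⁻ t, (g t : ℝ≥0∞) ∂(AddCircle.haarAddCircle (T := 1)) ≤
      ENNReal.ofReal (ε / 3 + ε / 3 - (q.eval 0).re) := by
    calc ∫⁻ t, (g t : ℝ≥0∞) ∂(AddCircle.haarAddCircle (T := 1))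
        ≤ ∫⁻ t : UnitAddCircle, ENNReal.ofReal
            (ε / 3 + ε / 3 - (q.eval (AddCircle.toCircle t : ℂ)).re)
            ∂AddCircle.haarAddCircle := by
          refine lintegral_mono fun t => ?_
          rw [← ENNReal.ofReal_coe_nnreal]
          exact ENNReal.ofReal_le_ofReal (hgq t).le
      _ = ENNReal.ofReal (∫ t : UnitAddCircle,
            (ε / 3 + ε / 3 - (q.eval (AddCircle.toCircle t : ℂ)).re)
            ∂AddCircle.haarAddCircle) := by
          refine (ofReal_integral_eq_lintegral_ofReal ((integrable_const _).sub hireq)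
            (.of_forall fun t => ?_)).symm
          exact (g t).coe_nonneg.trans (hgq t).le
      _ = ENNReal.ofReal (ε / 3 + ε / 3 - (q.eval 0).re) := by
          refine congrArg _ ((integral_sub (integrable_const _) hireq).trans ?_)
          rw [hre]
          simp
  have hqw : ENNReal.ofReal (-(q.eval 0).re) ≤ (-w a).toENNReal := by
    rw [← EReal.real_coe_toENNReal]
    exact EReal.toENNReal_le_toENNReal (by rw [EReal.coe_neg]; exact EReal.neg_le_neg_iff.2 hwa)
  calc (s.map ((↑) : ℝ≥0 → ℝ≥0∞)).lintegral AddCircle.haarAddCircle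
      = ∫⁻ t, (s t : ℝ≥0∞) ∂(AddCircle.haarAddCircle (T := 1)) :=
        (SimpleFunc.lintegral_eq_lintegral _ _).symm
    _ ≤ ENNReal.ofReal (ε / 3 + ε / 3 - (q.eval 0).re) + ENNReal.ofReal (ε / 3) :=
        hgint.trans (add_le_add_left hgle _)
    _ ≤ ENNReal.ofReal (-(q.eval 0).re) + ENNReal.ofReal (ε / 3 + ε / 3)
          + ENNReal.ofReal (ε / 3) := by
        gcongr
        rw [sub_eq_neg_add]
        exact ENNReal.ofReal_add_le
    _ = ENNReal.ofReal (-(q.eval 0).re) + ε := by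
        rw [add_assoc, ← ENNReal.ofReal_add (by positivity) (by positivity),
          show (ε / 3 + ε / 3 + ε / 3 : ℝ) = ε by ring, ENNReal.ofReal_coe_nnreal]
    _ ≤ (-w a).toENNReal + ε := by gcongr

theorem measurePreserving_circle_smul {n : ℕ} (e : Circle) :
    MeasurePreserving (fun x : Cn n => (e : ℂ) • x) :=
  volume_preserving_pi (fun _ => (rotation e).measurePreserving)

theorem lowerSemicontinuous_neg_toENNReal {X : Type*} [TopologicalSpace X] {w : X → EReal}
    (hw : UpperSemicontinuous w) : LowerSemicontinuous fun x => (-w x).toENNReal :=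
  Continuous.comp_upperSemicontinuous_antitone (g := fun y : EReal => (-y).toENNReal)
    continuous_neg.ereal_toENNReal hw
    fun _ _ hxy => EReal.toENNReal_le_toENNReal (EReal.neg_le_neg_iff.2 hxy)

/-- Sub-mean value property on balls, in terms of the nonnegative function `-w`. -/
theorem PSHNeg.lintegral_closedBall_le {n : ℕ} {Ω : Set (Cn n)} {w : Cn n → EReal}
    (hw : PSHNeg w Ω) (hwc : UpperSemicontinuous w) {a : Cn n} {r : ℝ}
    (hr : Metric.closedBall a r ⊆ Ω) :
    ∫⁻ x in Metric.closedBall a r, (-w x).toENNReal ≤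
      (-w a).toENNReal * volume (Metric.closedBall a r) := by
  have hmeas : Measurable fun x => (-w x).toENNReal :=
    (lowerSemicontinuous_neg_toENNReal hwc).measurable
  have hB : MeasurableSet (Metric.closedBall (0 : Cn n) r) := measurableSet_closedBall
  have htr : MeasurePreserving (fun x : Cn n => a + x) := measurePreserving_add_left volume a
  have hpre : (fun x : Cn n => a + x) ⁻¹' Metric.closedBall a r = Metric.closedBall 0 r := by
    simp
  rw [← htr.setLIntegral_comp_preimage measurableSet_closedBall hmeas,
    ← htr.measure_preimage measurableSet_closedBall.nullMeasurableSet, hpre]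
  have hrot : ∀ t : UnitAddCircle,
      ∫⁻ x in Metric.closedBall (0 : Cn n) r, (-w (a + x)).toENNReal =
      ∫⁻ x in Metric.closedBall (0 : Cn n) r,
        (-w (a + (AddCircle.toCircle t : ℂ) • x)).toENNReal := fun t => by
    have := (measurePreserving_circle_smul (n := n)
      (AddCircle.toCircle t)).setLIntegral_comp_preimage hB
      (hmeas.comp (measurable_const_add a))
    rw [show (fun x : Cn n => ((AddCircle.toCircle t : Circle) : ℂ) • x) ⁻¹'
      Metric.closedBall 0 r = Metric.closedBall 0 r by
        ext x; simp [norm_smul, Circle.norm_coe (AddCircle.toCircle t)]] at this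
    exact this.symm
  have hjoint : Measurable fun q : UnitAddCircle × Cn n =>
      (-w (a + (AddCircle.toCircle q.1 : ℂ) • q.2)).toENNReal := by
    have hc : Continuous fun q : UnitAddCircle × Cn n =>
        a + (AddCircle.toCircle q.1 : ℂ) • q.2 := by
      have : Continuous fun q : UnitAddCircle × Cn n => (AddCircle.toCircle q.1 : ℂ) :=
        continuous_subtype_val.comp (AddCircle.continuous_toCircle.comp continuous_fst)
      fun_prop
    exact hmeas.comp hc.measurable
  calc ∫⁻ x in Metric.closedBall (0 : Cn n) r, (-w (a + x)).toENNReal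
      = ∫⁻ t : UnitAddCircle, ∫⁻ x in Metric.closedBall (0 : Cn n) r,
          (-w (a + (AddCircle.toCircle t : ℂ) • x)).toENNReal ∂volume
          ∂AddCircle.haarAddCircle := by
        simp [← hrot]
    _ = ∫⁻ x in Metric.closedBall (0 : Cn n) r, ∫⁻ t : UnitAddCircle,
          (-w (a + (AddCircle.toCircle t : ℂ) • x)).toENNReal
          ∂AddCircle.haarAddCircle ∂volume := lintegral_lintegral_swap hjoint.aemeasurable
    _ ≤ ∫⁻ _ in Metric.closedBall (0 : Cn n) r, (-w a).toENNReal := by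
        refine setLIntegral_mono measurable_const fun x hx => ?_
        refine hw.lintegral_circle_le a x fun ζ hζ => hr ?_
        rw [mem_closedBall_iff_norm, add_sub_cancel_left, norm_smul]
        rw [mem_closedBall_zero_iff] at hx
        exact (mul_le_of_le_one_left (norm_nonneg x) hζ).trans hx
    _ = (-w a).toENNReal * volume (Metric.closedBall (0 : Cn n) r) := by simp

end MeanValue
section Comparison

/-- The extension of `w` from `Ω` by zero. -/
def zeroExtension {E : Type*} (w : E → EReal) (Ω : Set E) : E → EReal :=
  open Classical in fun x => if x ∈ Ω then w x else 0

theorem zeroExtension_of_mem {E : Type*} {w : E → EReal} {Ω : Set E} {x : E} (hx : x ∈ Ω) :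
    zeroExtension w Ω x = w x := if_pos hx

variable {E : Type*} [NormedAddCommGroup E] [NormedSpace ℂ E]

theorem PSHNeg.zeroExtension_nonpos {w : E → EReal} {Ω : Set E} (hw : PSHNeg w Ω) (x : E) :
    zeroExtension w Ω x ≤ 0 := by
  unfold zeroExtension
  split_ifs with hx
  exacts [hw.2 x hx, le_rfl]

theorem PSHNeg.upperSemicontinuous_zeroExtension {w : E → EReal} {Ω : Set E}
    (hw : PSHNeg w Ω) (hΩ : IsOpen Ω) : UpperSemicontinuous (zeroExtension w Ω) := by
  intro x y hy
  by_cases hx : x ∈ Ω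
  · rw [zeroExtension_of_mem hx] at hy
    filter_upwards [hw.1.1.upperSemicontinuousAt hΩ hx y hy, hΩ.mem_nhds hx] with z hz hzΩ
    rwa [zeroExtension_of_mem hzΩ]
  · have hy0 : 0 < y := by simpa [zeroExtension, hx] using hy
    exact .of_forall fun z => (hw.zeroExtension_nonpos z).trans_lt hy0

theorem PSHNeg.pshNeg_zeroExtension {w : E → EReal} {Ω : Set E} (hw : PSHNeg w Ω) (hΩ : IsOpen Ω) :
    PSHNeg (zeroExtension w Ω) Ω := by
  refine ⟨⟨(hw.upperSemicontinuous_zeroExtension hΩ).upperSemicontinuousOn Ω,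
    fun a b r hr hd p hp ζ hζ => ?_⟩, fun x _ => hw.zeroExtension_nonpos x⟩
  rw [zeroExtension_of_mem (hd ζ hζ)]
  exact hw.1.2 a b r hr hd p
    (fun ξ hξ => by simpa [zeroExtension_of_mem (hd ξ hξ.le)] using hp ξ hξ) ζ hζ

theorem measurable_neg_zeroExtension [MeasurableSpace E] [BorelSpace E] {w : E → EReal}
    {Ω : Set E} (hw : PSHNeg w Ω) (hΩ : IsOpen Ω) :
    Measurable fun x => (-zeroExtension w Ω x).toENNReal :=
  (lowerSemicontinuous_neg_toENNReal (hw.upperSemicontinuous_zeroExtension hΩ)).measurable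

/-- If the regularized supremum of a family of negative psh functions vanishes, then some
countable subfamily has supremum zero almost everywhere on a neighborhood of any point. -/
theorem exists_seq_ae_iInf_eq_zero {n : ℕ} {Ω : Set (Cn n)} (hΩ : IsOpen Ω)
    {S : Set (Cn n → EReal)} (hS : ∀ w ∈ S, PSHNeg w Ω) {z : Cn n} (hz : z ∈ Ω)
    (hsup : uscReg (fun x => ⨆ w ∈ S, w x) Ω z = 0) :
    ∃ ρ > 0, Metric.closedBall z ρ ⊆ Ω ∧ ∃ w : ℕ → Cn n → EReal, (∀ k, w k ∈ S) ∧
      ∀ᵐ x ∂volume.restrict (Metric.closedBall z ρ),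
        ⨅ k, (-zeroExtension (w k) Ω x).toENNReal = 0 := by
  obtain ⟨R, hR, hRΩ⟩ := Metric.nhds_basis_closedBall.mem_iff.1 (hΩ.mem_nhds hz)
  set ρ := R / 3 with hρ
  have hρ0 : 0 < ρ := by positivity
  refine ⟨ρ, hρ0, (Metric.closedBall_subset_closedBall (by linarith)).trans hRΩ, ?_⟩
  set V := volume (Metric.closedBall z R) with hV
  have hVtop : V ≠ ∞ := measure_closedBall_lt_top.ne
  have hex : ∀ k : ℕ, ∃ w ∈ S, ∫⁻ x in Metric.closedBall z ρ,
      (-zeroExtension w Ω x).toENNReal ≤ ENNReal.ofReal (1 / (k + 1)) * V := by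
    intro k
    have hk : (0 : ℝ) < 1 / (k + 1) := by positivity
    have hfreq : ∃ᶠ x in 𝓝[Ω] z, ((-(1 / (k + 1)) : ℝ) : EReal) < ⨆ w ∈ S, w x := by
      refine frequently_lt_of_lt_limsup (by isBoundedDefault) ?_
      change _ < uscReg (fun x => ⨆ w ∈ S, w x) Ω z
      rw [hsup]
      exact_mod_cast neg_neg_of_pos hk
    obtain ⟨a, ha, haz, haΩ⟩ := (hfreq.and_eventually (Filter.inter_mem
      (nhdsWithin_le_nhds (Metric.closedBall_mem_nhds z hρ0)) self_mem_nhdsWithin)).exists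
    simp only [lt_iSup_iff] at ha
    obtain ⟨w, hwS, hwa⟩ := ha
    have haz' : dist a z ≤ ρ := haz
    have hsub : Metric.closedBall a (2 * ρ) ⊆ Metric.closedBall z R :=
      Metric.closedBall_subset_closedBall' (by linarith)
    refine ⟨w, hwS, ?_⟩
    calc ∫⁻ x in Metric.closedBall z ρ, (-zeroExtension w Ω x).toENNReal
        ≤ ∫⁻ x in Metric.closedBall a (2 * ρ), (-zeroExtension w Ω x).toENNReal :=
          lintegral_mono_set (Metric.closedBall_subset_closedBall'
            (by rw [dist_comm]; linarith))
      _ ≤ (-zeroExtension w Ω a).toENNReal * volume (Metric.closedBall a (2 * ρ)) :=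
          ((hS w hwS).pshNeg_zeroExtension hΩ).lintegral_closedBall_le
            ((hS w hwS).upperSemicontinuous_zeroExtension hΩ) (hsub.trans hRΩ)
      _ ≤ ENNReal.ofReal (1 / (k + 1)) * V := by
          refine mul_le_mul' ?_ (measure_mono hsub)
          rw [zeroExtension_of_mem haΩ, ← EReal.real_coe_toENNReal]
          refine EReal.toENNReal_le_toENNReal (EReal.neg_le.1 ?_)
          exact_mod_cast hwa.le
  choose w hwS hw using hex
  refine ⟨w, hwS, ?_⟩
  refine (lintegral_eq_zero_iff
    (Measurable.iInf fun k => measurable_neg_zeroExtension (hS _ (hwS k)) hΩ)).1 ?_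
  refine le_antisymm (ge_of_tendsto' (x := atTop)
    (f := fun k : ℕ => ENNReal.ofReal (1 / ((k : ℝ) + 1)) * V) ?_ fun k =>
      (lintegral_mono fun x => iInf_le _ k).trans (hw k)) zero_le
  have h1 := ENNReal.tendsto_ofReal (tendsto_one_div_add_atTop_nhds_zero_nat (𝕜 := ℝ))
  simpa using ENNReal.Tendsto.mul_const h1 (.inr hVtop)

/-- A psh function that is bounded above by a usc function almost everywhere near a point is
bounded above by it at that point. -/
theorem PSHNeg.le_of_ae_le {n : ℕ} {Ω : Set (Cn n)} (hΩ : IsOpen Ω) {v A : Cn n → EReal}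
    (hv : PSHNeg v Ω) (hA : UpperSemicontinuousOn A Ω) {z : Cn n} (hz : z ∈ Ω) {ρ : ℝ}
    (hρ : 0 < ρ) (h : ∀ᵐ x ∂volume.restrict (Metric.closedBall z ρ), v x ≤ A x) :
    v z ≤ A z := by
  by_contra! hlt
  obtain ⟨c, hAc, hcv⟩ := EReal.lt_iff_exists_real_btwn.1 hlt
  obtain ⟨R, hR, hRs⟩ := Metric.nhds_basis_closedBall.mem_iff.1 (Filter.inter_mem
    (Filter.inter_mem (hA.upperSemicontinuousAt hΩ hz _ hAc) (hΩ.mem_nhds hz))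
    (Metric.closedBall_mem_nhds z hρ))
  have hball : ∀ᵐ x ∂volume.restrict (Metric.closedBall z R), v x ≤ A x :=
    ae_restrict_of_ae_restrict_of_subset (fun x hx => (hRs hx).2) h
  have hlower : ENNReal.ofReal (-c) * volume (Metric.closedBall z R) ≤
      ∫⁻ x in Metric.closedBall z R, (-zeroExtension v Ω x).toENNReal := by
    rw [← setLIntegral_const]
    refine lintegral_mono_ae ?_
    filter_upwards [hball, ae_restrict_mem measurableSet_closedBall] with x hx hxB
    have hxA : A x < (c : EReal) := (hRs hxB).1.1
    rw [zeroExtension_of_mem (hRs hxB).1.2, ← EReal.real_coe_toENNReal, EReal.coe_neg]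
    exact EReal.toENNReal_le_toENNReal (EReal.neg_le_neg_iff.2 (hx.trans hxA.le))
  have hupper := (hv.pshNeg_zeroExtension hΩ).lintegral_closedBall_le
    (hv.upperSemicontinuous_zeroExtension hΩ) (fun x hx => (hRs hx).1.2)
  have hpos : volume (Metric.closedBall z R) ≠ 0 :=
    (Metric.measure_closedBall_pos volume z hR).ne'
  have := (ENNReal.mul_le_mul_iff_left hpos measure_closedBall_lt_top.ne).1
    (hlower.trans hupper)
  refine this.not_gt ?_
  rw [zeroExtension_of_mem hz, ← EReal.real_coe_toENNReal, EReal.coe_neg]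
  exact EReal.toENNReal_lt_toENNReal (EReal.neg_nonneg.2 (hv.2 z hz))
    (EReal.neg_lt_neg_iff.2 hcv)

theorem le_of_forall_add_le {n : ℕ} {Ω : Set (Cn n)} (hΩ : IsOpen Ω) {v A : Cn n → EReal}
    (hv : PSHNeg v Ω) (hA : UpperSemicontinuousOn A Ω)
    {S : Set (Cn n → EReal)} (hS : ∀ w ∈ S, PSHNeg w Ω)
    (hsup : ∀ z ∈ Ω, uscReg (fun x => ⨆ w ∈ S, w x) Ω z = 0)
    (h : ∀ w ∈ S, ∀ z ∈ Ω, v z + w z ≤ A z) {z : Cn n} (hz : z ∈ Ω) : v z ≤ A z := by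
  obtain ⟨ρ, hρ, hρΩ, w, hwS, hw⟩ := exists_seq_ae_iInf_eq_zero hΩ hS hz (hsup z hz)
  refine hv.le_of_ae_le hΩ hA hz hρ ?_
  filter_upwards [hw, ae_restrict_mem measurableSet_closedBall] with x hx hxB
  have hxΩ := hρΩ hxB
  refine EReal.le_of_forall_lt_iff_le.1 fun c hc => ?_
  by_contra! hcv
  obtain ⟨d, hcd, hdv⟩ := EReal.lt_iff_exists_real_btwn.1 hcv
  have hcd' : c < d := by exact_mod_cast hcd
  have hlt : ⨅ k, (-zeroExtension (w k) Ω x).toENNReal < ENNReal.ofReal (d - c) := by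
    rw [hx]; simpa using hcd'
  obtain ⟨k, hk⟩ := iInf_lt_iff.1 hlt
  rw [zeroExtension_of_mem hxΩ, ← EReal.real_coe_toENNReal] at hk
  have hwk : ((c - d : ℝ) : EReal) ≤ w k x := by
    by_contra! hlt'
    refine hk.not_ge (EReal.toENNReal_le_toENNReal ?_)
    rw [← neg_sub c d, EReal.coe_neg]
    exact EReal.neg_le_neg_iff.2 hlt'.le
  have := (add_le_add hdv.le hwk).trans (h _ (hwS k) x hxΩ)
  rw [← EReal.coe_add, add_sub_cancel] at this
  exact this.not_gt hc

theorem PSHNeg.rooftop {Ω : Set E} (hΩ : IsOpen Ω) {u v : E → EReal} (hu : PSHNeg u Ω)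
    (hv : UpperSemicontinuousOn v Ω) : PSHNeg (Rooftop u v Ω) Ω :=
  ⟨plurisubharmonicOn_PEnv hΩ _, fun _ hx =>
    ((PEnv_le (hu.1.1.inf hv) hx).trans (min_le_left _ _)).trans (hu.2 _ hx)⟩

theorem le_asympRooftop {Ω : Set E} {ψ φ v : E → EReal} (hv : PlurisubharmonicOn v Ω)
    (hvψ : ∀ x ∈ Ω, v x ≤ ψ x) {C : ℝ} (hvφ : ∀ x ∈ Ω, v x ≤ φ x + (C : EReal)) {z : E}
    (hz : z ∈ Ω) : v z ≤ asympRooftop ψ φ Ω z := by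
  unfold asympRooftop
  refine le_trans ?_ (le_uscReg _ hz)
  exact le_iSup_of_le C (le_PEnv hv (fun x hx => le_min (hvψ x hx) (hvφ x hx)) hz)

theorem asympRooftop_le_rooftop_gp {Ω : Set E} (hΩ : IsOpen Ω) {ψ φ : E → EReal}
    (hφ : PSHNeg φ Ω) (hψ : PSHNeg ψ Ω) {z : E} (hz : z ∈ Ω) :
    asympRooftop ψ φ Ω z ≤ Rooftop ψ (gp φ Ω) Ω z := by
  have husc : ∀ C : ℝ, UpperSemicontinuousOn (fun x => φ x + (C : EReal)) Ω :=
    fun C => upperSemicontinuousOn_add_coe hφ.1.1 C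
  have hle : ∀ C : ℝ, ∀ x ∈ Ω, Rooftop ψ (fun x => φ x + (C : EReal)) Ω x ≤
      min (ψ x) (φ x + (C : EReal)) := fun C x hx => PEnv_le (hψ.1.1.inf (husc C)) hx
  refine le_PEnv (DiscMaxPrinciple.uscReg hΩ <| DiscMaxPrinciple.iSup fun C =>
    (plurisubharmonicOn_PEnv hΩ _).2) (fun x hx => uscReg_le
      (hψ.1.1.inf (upperSemicontinuousOn_uscReg _ _)) (fun y hy => iSup_le fun C => ?_) hx) hz
  refine le_min ((hle C y hy).trans (min_le_left _ _)) (le_trans ?_ (le_uscReg _ hy))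
  exact le_iSup₂_of_le (Rooftop ψ (fun x => φ x + (C : EReal)) Ω)
    ⟨hψ.rooftop hΩ (husc C), C, fun x hx => (hle C x hx).trans (min_le_right _ _)⟩ le_rfl

theorem rooftop_gp_le_asympRooftop_of_gp_eq_zero {n : ℕ} {Ω : Set (Cn n)} (hΩ : IsOpen Ω)
    {ψ φ w : Cn n → EReal} (hψ : PSHNeg ψ Ω)
    (hw0 : Set.EqOn (gp w Ω) 0 Ω) (hφw : ∀ z ∈ Ω, gp φ Ω z + w z ≤ φ z)
    {z : Cn n} (hz : z ∈ Ω) : Rooftop ψ (gp φ Ω) Ω z ≤ asympRooftop ψ φ Ω z := by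
  have husc : UpperSemicontinuousOn (gp φ Ω) Ω := upperSemicontinuousOn_uscReg _ _
  have hv := hψ.rooftop hΩ husc
  have hle : ∀ x ∈ Ω, Rooftop ψ (gp φ Ω) Ω x ≤ min (ψ x) (gp φ Ω x) :=
    fun x hx => PEnv_le (hψ.1.1.inf husc) hx
  refine le_of_forall_add_le hΩ hv (upperSemicontinuousOn_uscReg _ _) (fun _ h => h.1) hw0
    (fun w' hw' x hx => ?_) hz
  obtain ⟨C, hC⟩ := hw'.2
  refine le_asympRooftop (hv.add hw'.1).1 (fun y hy => ?_) (C := C) (fun y hy => ?_) hx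
  · exact (add_le_of_nonpos_right (hw'.1.2 y hy)).trans ((hle y hy).trans (min_le_left _ _))
  · calc Rooftop ψ (gp φ Ω) Ω y + w' y ≤ gp φ Ω y + (w y + (C : EReal)) :=
          add_le_add ((hle y hy).trans (min_le_right _ _)) (hC y hy)
      _ = gp φ Ω y + w y + (C : EReal) := (add_assoc _ _ _).symm
      _ ≤ φ y + (C : EReal) := add_le_add_left (hφw y hy) _

theorem rooftop_gp_le_asympRooftop_of_model {Ω : Set E} (hΩ : IsOpen Ω)
    {ψ φ : E → EReal} (hψ : PSHNeg ψ Ω)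
    (hmodel : ∀ σ : ℝ, σ ∈ Set.Ioo (0 : ℝ) 1 →
      ∃ C : ℝ, ∀ z ∈ Ω, gp φ Ω z ≤ (σ : EReal) * φ z + (C : EReal))
    {z : E} (hz : z ∈ Ω) : Rooftop ψ (gp φ Ω) Ω z ≤ asympRooftop ψ φ Ω z := by
  have husc : UpperSemicontinuousOn (gp φ Ω) Ω := upperSemicontinuousOn_uscReg _ _
  have hv := hψ.rooftop hΩ husc
  have hle : ∀ x ∈ Ω, Rooftop ψ (gp φ Ω) Ω x ≤ min (ψ x) (gp φ Ω x) :=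
    fun x hx => PEnv_le (hψ.1.1.inf husc) hx
  set v := Rooftop ψ (gp φ Ω) Ω
  have key : ∀ σ ∈ Set.Ioo (0 : ℝ) 1, ((σ⁻¹ : ℝ) : EReal) * v z ≤ asympRooftop ψ φ Ω z := by
    intro σ hσ
    obtain ⟨C, hC⟩ := hmodel σ hσ
    have hσ' : 0 < σ⁻¹ := inv_pos.2 hσ.1
    refine le_asympRooftop (hv.1.const_mul hσ') (fun x hx => ?_) (C := σ⁻¹ * C)
      (fun x hx => ?_) hz
    · refine le_trans ?_ ((hle x hx).trans (min_le_left _ _))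
      have h1 : (1 : EReal) ≤ ((σ⁻¹ : ℝ) : EReal) := by
        exact_mod_cast (one_le_inv₀ hσ.1).2 hσ.2.le
      simpa using EReal.mul_le_mul_of_nonpos_right h1 (hv.2 x hx)
    · rw [EReal.coe_mul_le_iff hσ', inv_inv, EReal.left_distrib_of_nonneg_of_ne_top
        (by exact_mod_cast hσ.1.le) (EReal.coe_ne_top σ), ← EReal.coe_mul,
        mul_inv_cancel_left₀ hσ.1.ne']
      exact ((hle x hx).trans (min_le_right _ _)).trans (hC x hx)
  have hvz := hv.2 z hz
  generalize v z = V at *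
  induction V with
  | bot => exact bot_le
  | top => simp at hvz
  | coe c =>
    have ht : Tendsto (fun σ : ℝ => (((σ⁻¹ : ℝ) : EReal) * (c : EReal))) (𝓝[<] 1)
        (𝓝 (c : EReal)) := by
      have h1 : ContinuousAt (fun σ : ℝ => σ⁻¹ * c) 1 := by fun_prop (disch := norm_num)
      have h2 := (continuous_coe_real_ereal.tendsto _).comp h1.tendsto
      simp only [inv_one, one_mul] at h2
      exact (h2.mono_left nhdsWithin_le_nhds).congr fun σ => EReal.coe_mul _ _
    refine le_of_tendsto ht ?_
    filter_upwards [Ioo_mem_nhdsLT one_pos] with σ hσ using key σ hσ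

end Comparison

/-- Proposition 7.2: sufficient conditions for the identity `P[φ](ψ) = P(ψ, g_φ)`. -/
theorem statement16 {n : ℕ} (Ω : Set (Cn n)) (hΩconn : IsConnected Ω) (hΩopen : IsOpen Ω)
    (hΩbd : Bornology.IsBounded Ω) (hΩbr : BRegular Ω)
    (φ ψ : Cn n → EReal) (hφ : PSHNeg φ Ω) (hψ : PSHNeg ψ Ω)
    (hcond :
      -- (i) `φ ≥ g_φ + w` with `w ∈ PSH⁻(Ω)` such that `g_w = 0`
      (∃ w : Cn n → EReal, PSHNeg w Ω ∧ Set.EqOn (gp w Ω) 0 Ω ∧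
        ∀ z ∈ Ω, gp φ Ω z + w z ≤ φ z) ∨
      -- (ii) `g_φ = 0`
      Set.EqOn (gp φ Ω) 0 Ω ∨
      -- (iii) `φ` has approximately model singularity
      (∀ σ : ℝ, σ ∈ Set.Ioo (0 : ℝ) 1 →
        ∃ C : ℝ, ∀ z ∈ Ω, gp φ Ω z ≤ (σ : EReal) * φ z + (C : EReal))) :
    Set.EqOn (asympRooftop ψ φ Ω) (Rooftop ψ (gp φ Ω) Ω) Ω := by
  intro z hz
  refine le_antisymm (asympRooftop_le_rooftop_gp hΩopen hφ hψ hz) ?_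
  rcases hcond with ⟨w, -, hw0, hφw⟩ | h0 | hmodel
  · exact rooftop_gp_le_asympRooftop_of_gp_eq_zero hΩopen hψ hw0 hφw hz
  · refine rooftop_gp_le_asympRooftop_of_gp_eq_zero hΩopen hψ h0 (fun x hx => ?_) hz
    rw [h0 hx, Pi.zero_apply, zero_add]
  · exact rooftop_gp_le_asympRooftop_of_model hΩopen hψ hmodel hz
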